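/- arXiv:2204.08298 — 2 statements merged into one kernel-verified Lean document; each statement's English description precedes it below -/
import Mathlib

section
/- Any memoryless quantum dynamics leads to Markovian statistics under sharp projective measurements: for every j with 2 ≤ j ≤ n and every outcome sequence x_1,…,x_j ∈ Fin d with P(x_{j-1},…,x_1) := tr[𝒫^{x_{j-1}}(Λ_{j-1}(⋯ Λ_2(𝒫^{x_1}(ρ₁)) ⋯ ))] > 0, the conditional probability P(x_j,…,x_1)/P(x_{j-1},…,x_1) equals ⟨x_j| Λ_j(|x_{j-1}⟩⟨x_{j-1}|) |x_j⟩; in particular it is independent of x_1,…,x_{j-2}. -/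
open Matrix ComplexOrder

noncomputable section

/-- Sharp projective measurement in the standard basis with outcome `x`:
`𝒫^x(A) = |x⟩⟨x| A |x⟩⟨x|`. -/
def measM {d : ℕ} (x : Fin d) (A : Matrix (Fin d) (Fin d) ℂ) :
    Matrix (Fin d) (Fin d) ℂ :=
  Matrix.single x x 1 * A * Matrix.single x x 1

/-- A map on `d × d` complex matrices is completely positive and trace preserving,
given by a finite Kraus family: `Λ(A) = ∑ ℓ, L ℓ A (L ℓ)†` with `∑ ℓ, (L ℓ)† L ℓ = 1`. -/
def IsKrausCPTP {d : ℕ} (Λ : Matrix (Fin d) (Fin d) ℂ → Matrix (Fin d) (Fin d) ℂ) : Prop :=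
  ∃ (m : ℕ) (L : Fin m → Matrix (Fin d) (Fin d) ℂ),
    (∀ A, Λ A = ∑ ℓ, L ℓ * A * (L ℓ)ᴴ) ∧ (∑ ℓ, (L ℓ)ᴴ * L ℓ = 1)

/-- The subnormalised state after probing a memoryless quantum dynamics with sharp
standard-basis measurements at all times `1, …, j`:
`evolAll Λ ρ x j = 𝒫^{x_j}(Λ_j(⋯ Λ_2(𝒫^{x_1}(ρ)) ⋯ ))`, whose trace is the joint
probability `P(x_j,…,x_1)`. -/
def evolAll {d : ℕ} (Λ : ℕ → Matrix (Fin d) (Fin d) ℂ → Matrix (Fin d) (Fin d) ℂ)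
    (ρ : Matrix (Fin d) (Fin d) ℂ) (x : ℕ → Fin d) : ℕ → Matrix (Fin d) (Fin d) ℂ
  | 0 => ρ
  | 1 => measM (x 1) ρ
  | (j + 2) => measM (x (j + 2)) (Λ (j + 2) (evolAll Λ ρ x (j + 1)))

theorem measM_eq {d : ℕ} (x : Fin d) (A : Matrix (Fin d) (Fin d) ℂ) :
    measM x A = A x x • Matrix.single x x (1 : ℂ) := by
  simp [measM, Matrix.smul_single]

theorem trace_measM {d : ℕ} (x : Fin d) (A : Matrix (Fin d) (Fin d) ℂ) :
    (measM x A).trace = A x x := by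
  rw [measM_eq, Matrix.trace_smul, Matrix.trace_single_eq_same, smul_eq_mul, mul_one]

theorem measM_herm {d : ℕ} (x : Fin d) {A : Matrix (Fin d) (Fin d) ℂ} (hA : A.IsHermitian) :
    (measM x A).IsHermitian := by
  have h := Matrix.isHermitian_mul_mul_conjTranspose (Matrix.single x x (1 : ℂ)) hA
  simpa [measM, Matrix.conjTranspose_single] using h

theorem kraus_herm {d : ℕ} {Λ : Matrix (Fin d) (Fin d) ℂ → Matrix (Fin d) (Fin d) ℂ}
    (h : IsKrausCPTP Λ) {A : Matrix (Fin d) (Fin d) ℂ} (hA : A.IsHermitian) :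
    (Λ A).IsHermitian := by
  obtain ⟨m, L, hL, -⟩ := h
  rw [hL, Matrix.IsHermitian, Matrix.conjTranspose_sum]
  exact Finset.sum_congr rfl fun l _ => Matrix.isHermitian_mul_mul_conjTranspose (L l) hA

theorem kraus_smul {d : ℕ} {Λ : Matrix (Fin d) (Fin d) ℂ → Matrix (Fin d) (Fin d) ℂ}
    (h : IsKrausCPTP Λ) (c : ℂ) (A : Matrix (Fin d) (Fin d) ℂ) :
    Λ (c • A) = c • Λ A := by
  obtain ⟨m, L, hL, -⟩ := h
  simp [hL, Finset.smul_sum]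

theorem evolAll_herm {d n : ℕ} {ρ : Matrix (Fin d) (Fin d) ℂ}
    {Λ : ℕ → Matrix (Fin d) (Fin d) ℂ → Matrix (Fin d) (Fin d) ℂ}
    (hρ : ρ.IsHermitian) (hΛ : ∀ k, 2 ≤ k → k ≤ n → IsKrausCPTP (Λ k)) (x : ℕ → Fin d) :
    ∀ k, k + 1 ≤ n → (evolAll Λ ρ x (k + 1)).IsHermitian
  | 0, _ => measM_herm _ hρ
  | k + 1, hk => measM_herm _
      (kraus_herm (hΛ (k + 2) (by omega) hk) (evolAll_herm hρ hΛ x k (by omega)))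

theorem evolAll_eq {d : ℕ} (ρ : Matrix (Fin d) (Fin d) ℂ)
    (Λ : ℕ → Matrix (Fin d) (Fin d) ℂ → Matrix (Fin d) (Fin d) ℂ) (x : ℕ → Fin d) (k : ℕ) :
    evolAll Λ ρ x (k + 1) =
      (evolAll Λ ρ x (k + 1)).trace • Matrix.single (x (k + 1)) (x (k + 1)) (1 : ℂ) := by
  cases k <;> rw [evolAll, trace_measM, measM_eq]

/-- Any memoryless quantum dynamics leads to Markovian statistics under sharp
projective measurements: whenever `P(x_{j-1},…,x_1) > 0`, the conditional probability
`P(x_j,…,x_1)/P(x_{j-1},…,x_1)` equals `⟨x_j| Λ_j(|x_{j-1}⟩⟨x_{j-1}|) |x_j⟩`;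
in particular it is independent of `x_1, …, x_{j-2}`. -/
theorem memoryless_quantum_markov {d n : ℕ}
    (ρ : Matrix (Fin d) (Fin d) ℂ)
    (Λ : ℕ → Matrix (Fin d) (Fin d) ℂ → Matrix (Fin d) (Fin d) ℂ)
    (hρ : ρ.PosSemidef) (hρtr : ρ.trace = 1)
    (hΛ : ∀ k, 2 ≤ k → k ≤ n → IsKrausCPTP (Λ k))
    (j : ℕ) (hj2 : 2 ≤ j) (hjn : j ≤ n) (x : ℕ → Fin d)
    (hpos : 0 < ((evolAll Λ ρ x (j - 1)).trace).re) :
    ((evolAll Λ ρ x j).trace).re / ((evolAll Λ ρ x (j - 1)).trace).re =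
      ((Λ j (Matrix.single (x (j - 1)) (x (j - 1)) 1)) (x j) (x j)).re := by
  obtain ⟨k, rfl⟩ : ∃ k, j = k + 2 := ⟨j - 2, by omega⟩
  have hk : k + 2 - 1 = k + 1 := rfl
  rw [hk] at hpos ⊢
  have hH := evolAll_herm hρ.isHermitian hΛ x k (by omega)
  have him : ((evolAll Λ ρ x (k + 1)).trace).im = 0 := by
    have h : star (evolAll Λ ρ x (k + 1)).trace = (evolAll Λ ρ x (k + 1)).trace := by
      rw [← Matrix.trace_conjTranspose, hH.eq]
    exact Complex.conj_eq_iff_im.mp h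
  have hstep : (evolAll Λ ρ x (k + 2)).trace = (evolAll Λ ρ x (k + 1)).trace *
      (Λ (k + 2) (Matrix.single (x (k + 1)) (x (k + 1)) 1)) (x (k + 2)) (x (k + 2)) := by
    rw [evolAll, trace_measM]
    conv_lhs => rw [evolAll_eq]
    rw [kraus_smul (hΛ (k + 2) hj2 hjn), Matrix.smul_apply, smul_eq_mul]
  rw [hstep, Complex.mul_re, him, zero_mul, sub_zero, mul_div_cancel_left₀ _ hpos.ne']
end
end

section
/- For the incompatible-statistics circuit, the statistics when all four times are measured equal P(x_4, x_3, x_2, x_1) = 1/8 if x_3 = 0 and 0 otherwise (for all x_1, x_2, x_4 ∈ Fin 2), while the sub-statistics with no measurement at t_2 equal P(x_4, x_3, 𝓘_2, x_1) = 1/2 if x_3 = 0 and x_4 = 0, and 0 otherwise (for all x_1 ∈ Fin 2). -/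
open Matrix Kronecker

noncomputable section

/-- Standard-basis projector `|x⟩⟨x|` on a qubit. -/
def proj (x : Fin 2) : Matrix (Fin 2) (Fin 2) ℂ := Matrix.single x x 1

/-- The Hadamard gate `H = (1/√2)·!![1,1;1,-1]`. -/
def Hgate : Matrix (Fin 2) (Fin 2) ℂ := (Real.sqrt 2 : ℂ)⁻¹ • !![1, 1; 1, -1]

/-- Sharp standard-basis measurement of the system qubit (first factor) of a
two-qubit state: `𝒫^x(A) = (|x⟩⟨x| ⊗ 𝟙) A (|x⟩⟨x| ⊗ 𝟙)`. -/
def measSys (x : Fin 2) (A : Matrix (Fin 2 × Fin 2) (Fin 2 × Fin 2) ℂ) :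
    Matrix (Fin 2 × Fin 2) (Fin 2 × Fin 2) ℂ :=
  (proj x ⊗ₖ (1 : Matrix (Fin 2) (Fin 2) ℂ)) * A * (proj x ⊗ₖ (1 : Matrix (Fin 2) (Fin 2) ℂ))

/-- Optionally measure the system qubit: `some x` applies `𝒫^x`, `none` the identity. -/
def optMeasSys (o : Option (Fin 2)) (A : Matrix (Fin 2 × Fin 2) (Fin 2 × Fin 2) ℂ) :
    Matrix (Fin 2 × Fin 2) (Fin 2 × Fin 2) ℂ :=
  o.elim A fun x => measSys x A

/-- The Hadamard gate applied to the system qubit of a two-qubit state. -/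
def Hsys (A : Matrix (Fin 2 × Fin 2) (Fin 2 × Fin 2) ℂ) :
    Matrix (Fin 2 × Fin 2) (Fin 2 × Fin 2) ℂ :=
  (Hgate ⊗ₖ (1 : Matrix (Fin 2) (Fin 2) ℂ)) * A * (Hgate ⊗ₖ (1 : Matrix (Fin 2) (Fin 2) ℂ))ᴴ

/-- The two-qubit CNOT with the system (first factor) as control and the environment
(second factor) as target: `|s,e⟩ ↦ |s, e+s⟩`. -/
def CNOTS : Matrix (Fin 2 × Fin 2) (Fin 2 × Fin 2) ℂ :=
  Matrix.of fun p q => if p.1 = q.1 ∧ p.2 = q.2 + q.1 then 1 else 0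

/-- The two-qubit CNOT with the environment (second factor) as control and the
system (first factor) as target: `|s,e⟩ ↦ |s+e, e⟩`. -/
def CNOTE : Matrix (Fin 2 × Fin 2) (Fin 2 × Fin 2) ℂ :=
  Matrix.of fun p q => if p.2 = q.2 ∧ p.1 = q.1 + q.2 then 1 else 0

/-- The partial trace over the system qubit (first factor) of a two-qubit matrix. -/
def ptraceSys (A : Matrix (Fin 2 × Fin 2) (Fin 2 × Fin 2) ℂ) :
    Matrix (Fin 2) (Fin 2) ℂ :=
  Matrix.of fun e e' => ∑ s : Fin 2, A (s, e) (s, e')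

/-- The initial joint system–environment state `φ = (1/2)(|00⟩⟨00| + |11⟩⟨11|)` of
the incompatible-statistics circuit (Fig. 3). -/
def phi0 : Matrix (Fin 2 × Fin 2) (Fin 2 × Fin 2) ℂ :=
  (1 / 2 : ℂ) • (proj 0 ⊗ₖ proj 0 + proj 1 ⊗ₖ proj 1)

/-- The (subnormalised) system–environment state of the incompatible-statistics
circuit (Fig. 3) immediately before the measurement at `t₃`: start from `φ`,
optionally measure the system (`m₁`), apply `H` on the system, optionally measure
(`m₂`), apply `H` on the system, apply CNOT controlled on the system, then discard
the system (partial trace) and re-prepare it in `|0⟩⟨0|`. -/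
def incPre3 (m1 m2 : Option (Fin 2)) : Matrix (Fin 2 × Fin 2) (Fin 2 × Fin 2) ℂ :=
  let s1 := optMeasSys m1 phi0
  let s2 := Hsys s1
  let s3 := optMeasSys m2 s2
  let s4 := Hsys s3
  let s5 := CNOTS * s4 * CNOTSᴴ
  proj 0 ⊗ₖ ptraceSys s5

/-- The final subnormalised two-qubit state of the incompatible-statistics circuit
(Fig. 3): after `incPre3`, measure the system (`𝒫^{x₃}`), apply CNOT controlled on
the environment, and measure the system (`𝒫^{x₄}`). -/
def incFinal (m1 m2 : Option (Fin 2)) (x3 x4 : Fin 2) :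
    Matrix (Fin 2 × Fin 2) (Fin 2 × Fin 2) ℂ :=
  measSys x4 (CNOTE * measSys x3 (incPre3 m1 m2) * CNOTEᴴ)
lemma measSys_apply (x : Fin 2) (A : Matrix (Fin 2 × Fin 2) (Fin 2 × Fin 2) ℂ) (s e s' e' : Fin 2) :
    measSys x A (s, e) (s', e') = if s = x ∧ s' = x then A (s, e) (s', e') else 0 := by
  fin_cases x <;> fin_cases s <;> fin_cases s' <;> fin_cases e <;> fin_cases e' <;>
    simp [measSys, proj, Matrix.mul_apply, Fintype.sum_prod_type, Matrix.single_apply, Matrix.one_apply]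

lemma half_aux : ((Real.sqrt 2 : ℂ))⁻¹ * ((Real.sqrt 2 : ℂ))⁻¹ = 1 / 2 := by
  rw [← mul_inv, ← Complex.ofReal_mul, Real.mul_self_sqrt (by norm_num)]
  norm_num

lemma Hsys_apply (A : Matrix (Fin 2 × Fin 2) (Fin 2 × Fin 2) ℂ) (s e s' e' : Fin 2) :
    Hsys A (s, e) (s', e') = 1 / 2 * (A (0, e) (0, e') + (if s' = 0 then 1 else -1) * A (0, e) (1, e')
      + (if s = 0 then 1 else -1) * A (1, e) (0, e')
      + (if s = 0 then 1 else -1) * (if s' = 0 then 1 else -1) * A (1, e) (1, e')) := by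
  rw [← half_aux]
  fin_cases s <;> fin_cases s' <;> fin_cases e <;> fin_cases e' <;>
    simp [Hsys, Hgate, Matrix.mul_apply, Fintype.sum_prod_type, Matrix.one_apply] <;> ring

lemma CNOTS_apply (A : Matrix (Fin 2 × Fin 2) (Fin 2 × Fin 2) ℂ) (s e s' e' : Fin 2) :
    (CNOTS * A * CNOTSᴴ) (s, e) (s', e') = A (s, e + s) (s', e' + s') := by
  fin_cases s <;> fin_cases s' <;> fin_cases e <;> fin_cases e' <;>
    simp [CNOTS, Matrix.mul_apply, Fintype.sum_prod_type]

lemma CNOTE_apply (A : Matrix (Fin 2 × Fin 2) (Fin 2 × Fin 2) ℂ) (s e s' e' : Fin 2) :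
    (CNOTE * A * CNOTEᴴ) (s, e) (s', e') = A (s + e, e) (s' + e', e') := by
  fin_cases s <;> fin_cases s' <;> fin_cases e <;> fin_cases e' <;>
    simp [CNOTE, Matrix.mul_apply, Fintype.sum_prod_type]

lemma phi0_apply (s e s' e' : Fin 2) :
    phi0 (s, e) (s', e') = if s = e ∧ s' = e ∧ e' = e then 1 / 2 else 0 := by
  fin_cases s <;> fin_cases s' <;> fin_cases e <;> fin_cases e' <;>
    simp [phi0, proj, Matrix.single_apply]

/-- For the incompatible-statistics circuit, the statistics when all four times are
measured equal `P(x₄,x₃,x₂,x₁) = 1/8` if `x₃ = 0` and `0` otherwise, while the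
sub-statistics with no measurement at `t₂` equal `P(x₄,x₃,𝓘₂,x₁) = 1/2` if `x₃ = 0`
and `x₄ = 0`, and `0` otherwise. -/
theorem inc_statistics (x1 x2 x3 x4 : Fin 2) :
    ((incFinal (some x1) (some x2) x3 x4).trace =
        if x3 = 0 then (1 / 8 : ℂ) else 0) ∧
    ((incFinal (some x1) none x3 x4).trace =
        if x3 = 0 ∧ x4 = 0 then (1 / 2 : ℂ) else 0) := by
  have key : ∀ m2, (incFinal (some x1) m2 x3 x4).trace = if x3 = 0 then
      ptraceSys (CNOTS * Hsys (optMeasSys m2 (Hsys (measSys x1 phi0))) * CNOTSᴴ) x4 x4 else 0 := by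
    intro m2
    fin_cases x3 <;> fin_cases x4 <;>
      simp [incFinal, incPre3, optMeasSys, Matrix.trace, Fintype.sum_prod_type, measSys_apply,
        CNOTE_apply, proj, Matrix.single_apply]
  have h11 : (1 : Fin 2) + 1 = 0 := rfl
  rw [key, key]
  simp only [ptraceSys, Matrix.of_apply, CNOTS_apply, Hsys_apply, optMeasSys, Option.elim,
    measSys_apply, phi0_apply, Fin.sum_univ_two]
  fin_cases x1 <;> fin_cases x2 <;> fin_cases x3 <;> fin_cases x4 <;> norm_num [h11]
end
end
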